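/- Let Q, S, C be finite nonempty sets, let F be a finite nonempty family of functions from Q to S that is universal (for all distinct u, û ∈ Q, a uniformly random f ∈ F satisfies Pr[f(u) = f(û)] ≤ 1/|S|), and let φ : Q → C be any function. Let p : Q → ℝ be nonnegative with Σ_{u∈Q} p(u) ≤ 1, and let δ > 0 satisfy p(u) ≤ δ for all u ∈ Q. Then the average over f ∈ F (with uniform weights) of Σ_{s∈S} Σ_{c∈C} | Σ_{u : f(u)=s, φ(u)=c} p(u) − (1/|S|)·Σ_{u : φ(u)=c} p(u) | is at most √(|S|·|C|·δ). -/

import Mathlib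

open Finset

/-- The squared fibre masses of `g` add up to the weighted number of collisions of `g`. -/
theorem sum_sq_fiber_sum {Q T : Type*} [Fintype Q] [Fintype T] [DecidableEq T]
    (g : Q → T) (p : Q → ℝ) :
    ∑ t : T, (∑ u ∈ univ.filter fun u => g u = t, p u) ^ 2 =
      ∑ u : Q, ∑ v : Q, if g u = g v then p u * p v else 0 := by
  simp_rw [sq, sum_mul_sum, sum_filter]
  rw [sum_comm]
  refine sum_congr rfl fun u _ => ?_
  rw [sum_ite_eq]
  simp only [mem_univ, if_true, eq_comm]

/-- Sum of squared deviations from the mean. -/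
theorem sum_sub_mean_sq {S : Type*} [Fintype S] [Nonempty S] (a : S → ℝ) (P : ℝ)
    (h : ∑ s, a s = P) :
    ∑ s, (a s - (Fintype.card S : ℝ)⁻¹ * P) ^ 2 =
      ∑ s, a s ^ 2 - (Fintype.card S : ℝ)⁻¹ * P ^ 2 := by
  have hS : (Fintype.card S : ℝ) ≠ 0 := by simp
  simp_rw [sub_sq, sum_add_distrib, sum_sub_distrib, ← sum_mul, ← mul_sum, h]
  simp only [sum_const, card_univ, nsmul_eq_mul]
  field_simp
  ring

/-- The squared L2 distance between the joint weight of `(f u, φ u)` and the product of the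
uniform distribution with the weight of `φ u`, as a sum over pairs colliding under `φ`. -/
theorem sum_sum_sub_uniform_sq {Q S C : Type*} [Fintype Q] [Fintype S] [Fintype C]
    [DecidableEq S] [DecidableEq C] [Nonempty S] (f : Q → S) (φ : Q → C) (p : Q → ℝ) :
    ∑ s : S, ∑ c : C,
        ((∑ u ∈ univ.filter fun u => f u = s ∧ φ u = c, p u) -
          (Fintype.card S : ℝ)⁻¹ * ∑ u ∈ univ.filter fun u => φ u = c, p u) ^ 2 =
      ∑ u : Q, ∑ v : Q, if φ u = φ v then
        p u * p v * ((if f u = f v then 1 else 0) - (Fintype.card S : ℝ)⁻¹) else 0 := by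
  have hmarg (c : C) : ∑ s : S, ∑ u ∈ univ.filter (fun u => f u = s ∧ φ u = c), p u =
      ∑ u ∈ univ.filter (fun u => φ u = c), p u := by
    rw [← sum_fiberwise (univ.filter fun u => φ u = c) f p]
    simp only [filter_filter, and_comm]
  have hjoint := sum_sq_fiber_sum (fun u => (f u, φ u)) p
  simp only [Fintype.sum_prod_type, Prod.mk.injEq] at hjoint
  rw [sum_comm]
  simp_rw [fun c => sum_sub_mean_sq _ _ (hmarg c)]
  rw [sum_sub_distrib, sum_comm, hjoint, ← mul_sum, sum_sq_fiber_sum]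
  simp_rw [mul_sum, ← sum_sub_distrib]
  refine sum_congr rfl fun u _ => sum_congr rfl fun v _ => ?_
  by_cases h1 : φ u = φ v <;> by_cases h2 : f u = f v <;> simp [h1, h2] <;> ring

/-- For a universal family, the total squared L2 distance is at most `|F| * δ`. -/
theorem sum_universal_sub_uniform_sq_le {Q S C : Type*} [Fintype Q] [Fintype S] [Fintype C]
    [DecidableEq Q] [DecidableEq S] [DecidableEq C] [Nonempty S]
    (F : Finset (Q → S)) (hF : F.Nonempty)
    (huniv : ∀ u uhat : Q, u ≠ uhat →
      ((F.filter fun f => f u = f uhat).card : ℝ) / F.card ≤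
        1 / Fintype.card S)
    (φ : Q → C) (p : Q → ℝ) (hp : ∀ u, 0 ≤ p u) (hp1 : ∑ u : Q, p u ≤ 1)
    (δ : ℝ) (hδ : 0 ≤ δ) (hpδ : ∀ u, p u ≤ δ) :
    ∑ f ∈ F, ∑ s : S, ∑ c : C,
        ((∑ u ∈ univ.filter fun u => f u = s ∧ φ u = c, p u) -
          (Fintype.card S : ℝ)⁻¹ * ∑ u ∈ univ.filter fun u => φ u = c, p u) ^ 2
      ≤ F.card * δ := by
  have hF0 : (0 : ℝ) < F.card := by exact_mod_cast hF.card_pos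
  have hterm (u v : Q) :
      (∑ f ∈ F, if φ u = φ v then
        p u * p v * ((if f u = f v then 1 else 0) - (Fintype.card S : ℝ)⁻¹) else 0) ≤
      if u = v then F.card * (p u * p u) else 0 := by
    by_cases hφ : φ u = φ v
    · simp only [hφ, if_true]
      rw [← mul_sum, sum_sub_distrib, sum_boole, sum_const, nsmul_eq_mul]
      by_cases huv : u = v
      · subst huv
        simp only [filter_true, if_true]
        have : 0 ≤ (F.card : ℝ) * (Fintype.card S : ℝ)⁻¹ := by positivity
        nlinarith [mul_nonneg (mul_nonneg (hp u) (hp u)) this]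
      · rw [if_neg huv]
        have h := huniv u v huv
        rw [div_le_iff₀ hF0, one_div, mul_comm] at h
        exact mul_nonpos_of_nonneg_of_nonpos (mul_nonneg (hp u) (hp v)) (by linarith)
    · have huv : u ≠ v := fun h => hφ (congrArg φ h)
      simp [hφ, huv]
  simp_rw [sum_sum_sub_uniform_sq]
  rw [sum_comm]
  simp_rw [fun u : Q => sum_comm (s := F) (t := (univ : Finset Q)) (f := fun f v =>
    if φ u = φ v then
      p u * p v * ((if f u = f v then 1 else 0) - (Fintype.card S : ℝ)⁻¹) else 0)]
  calc _ ≤ ∑ u : Q, ∑ v : Q, (if u = v then F.card * (p u * p u) else 0) :=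
        sum_le_sum fun u _ => sum_le_sum fun v _ => hterm u v
    _ = F.card * ∑ u : Q, p u * p u := by simp [mul_sum]
    _ ≤ F.card * ∑ u : Q, p u * δ := by
        gcongr with u
        · exact hp u
        · exact hpδ u
    _ ≤ F.card * δ := by
        rw [← sum_mul]
        gcongr
        exact mul_le_of_le_one_left hδ hp1

/-- L1 privacy-amplification bound for universal hash families.
If `F` is a nonempty universal family of functions `Q → S` (for distinct
`u, û`, a uniform `f ∈ F` satisfies `Pr[f u = f û] ≤ 1/|S|`), `φ : Q → C` is
arbitrary, `p : Q → ℝ` is nonnegative with total mass at most `1` and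
`p u ≤ δ` for all `u` (where `δ > 0`), then the average over `f ∈ F` of
`Σ_s Σ_c |Σ_{u : f u = s, φ u = c} p u − (1/|S|)·Σ_{u : φ u = c} p u|` is at
most `√(|S|·|C|·δ)`. -/
theorem stmt_9 {Q S C : Type*} [Fintype Q] [Fintype S] [Fintype C]
    [DecidableEq Q] [DecidableEq S] [DecidableEq C]
    [Nonempty Q] [Nonempty S] [Nonempty C]
    (F : Finset (Q → S)) (hF : F.Nonempty)
    (huniv : ∀ u uhat : Q, u ≠ uhat →
      ((F.filter fun f => f u = f uhat).card : ℝ) / F.card ≤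
        1 / Fintype.card S)
    (φ : Q → C) (p : Q → ℝ) (hp : ∀ u, 0 ≤ p u) (hp1 : ∑ u : Q, p u ≤ 1)
    (δ : ℝ) (hδ : 0 < δ) (hpδ : ∀ u, p u ≤ δ) :
    (F.card : ℝ)⁻¹ *
        ∑ f ∈ F, ∑ s : S, ∑ c : C,
          |(∑ u ∈ univ.filter fun u => f u = s ∧ φ u = c, p u) -
            (Fintype.card S : ℝ)⁻¹ * ∑ u ∈ univ.filter fun u => φ u = c, p u|
      ≤ Real.sqrt (Fintype.card S * Fintype.card C * δ) := by
  have hF0 : (0 : ℝ) < F.card := by exact_mod_cast hF.card_pos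
  have hL2 := sum_universal_sub_uniform_sq_le F hF huniv φ p hp hp1 δ hδ.le hpδ
  have hCS := sq_sum_le_card_mul_sum_sq (s := F ×ˢ (univ : Finset (S × C))) (f := fun x =>
    |(∑ u ∈ univ.filter fun u => x.1 u = x.2.1 ∧ φ u = x.2.2, p u) -
      (Fintype.card S : ℝ)⁻¹ * ∑ u ∈ univ.filter fun u => φ u = x.2.2, p u|)
  simp only [sum_product, Fintype.sum_prod_type, card_product, card_univ, Fintype.card_prod,
    sq_abs, Nat.cast_mul] at hCS
  apply Real.le_sqrt_of_sq_le
  rw [mul_pow, inv_pow, inv_mul_le_iff₀ (by positivity)]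
  refine hCS.trans ((mul_le_mul_of_nonneg_left hL2 (by positivity)).trans_eq ?_)
  ring
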